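/- Let S be an ample semigroup with unary operations plus and star. Then the following are equivalent. (1) There exist an inverse semigroup Q and an injective semigroup homomorphism φ : S → Q with φ(plus(a)) = (φ a)·(φ a)⁻¹ and φ(star(a)) = (φ a)⁻¹·(φ a) for all a ∈ S, such that every q ∈ Q can be written as q = (φ a)⁻¹·(φ b) for some a, b ∈ S. (2) For all b, c ∈ S there exist u, v ∈ S such that u·b = v·c, plus(u) = plus(v), plus(v) = plus(v·c), and b·star(c) = star(u)·b. -/

import Mathlib

universe u

/-- The preorder ≤_{𝓛*} on a semigroup, defined via `S¹ = WithOne S`. -/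
def LeLStar {S : Type*} [Semigroup S] (a b : S) : Prop :=
  ∀ x y : WithOne S,
    (b : WithOne S) * x = (b : WithOne S) * y → (a : WithOne S) * x = (a : WithOne S) * y

/-- The relation 𝓡* on a semigroup, defined via `S¹ = WithOne S`. -/
def RStar {S : Type*} [Semigroup S] (a b : S) : Prop :=
  ∀ x y : WithOne S,
    x * (a : WithOne S) = y * (a : WithOne S) ↔ x * (b : WithOne S) = y * (b : WithOne S)

/-- `plus` and `star` make the semigroup `S` an ample semigroup. -/
structure IsAmple {S : Type*} [Semigroup S] (plus star : S → S) : Prop where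
  comm : ∀ e f : S, e * e = e → f * f = f → e * f = f * e
  plus_idem : ∀ a : S, plus a * plus a = plus a
  rStar : ∀ a : S, RStar a (plus a)
  star_idem : ∀ a : S, star a * star a = star a
  lStar : ∀ a : S, LeLStar a (star a) ∧ LeLStar (star a) a
  mul_plus : ∀ a b : S, a * plus b = plus (a * b) * a
  star_mul : ∀ a b : S, star a * b = b * star (a * b)

/-- The square condition characterizing ample semigroups that are left I-orders. -/
def LeftOreSquare {S : Type*} [Semigroup S] (plus star : S → S) : Prop :=
  ∀ b c : S, ∃ u v : S,
    u * b = v * c ∧ plus u = plus v ∧ plus v = plus (v * c) ∧ b * star c = star u * b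

namespace IsAmple

variable {S : Type*} [Semigroup S] {plus star : S → S}

theorem plus_mul_self (h : IsAmple plus star) (a : S) : plus a * a = a := by
  have := (h.rStar a (plus a : S) 1).2
    (by rw [one_mul, ← WithOne.coe_mul, h.plus_idem])
  rw [one_mul, ← WithOne.coe_mul] at this
  exact WithOne.coe_inj.1 this

theorem mul_star_self (h : IsAmple plus star) (a : S) : a * star a = a := by
  have := (h.lStar a).1 (star a : S) 1
    (by rw [mul_one, ← WithOne.coe_mul, h.star_idem])
  rw [mul_one, ← WithOne.coe_mul] at this
  exact WithOne.coe_inj.1 this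

theorem mul_plus_cancel (h : IsAmple plus star) {a x y : S} (e : x * a = y * a) :
    x * plus a = y * plus a := by
  have := (h.rStar a x y).1 (by rw [← WithOne.coe_mul, ← WithOne.coe_mul, e])
  rw [← WithOne.coe_mul, ← WithOne.coe_mul] at this
  exact WithOne.coe_inj.1 this

theorem star_mul_cancel (h : IsAmple plus star) {a x y : S} (e : a * x = a * y) :
    star a * x = star a * y := by
  have := (h.lStar a).2 x y (by rw [← WithOne.coe_mul, ← WithOne.coe_mul, e])
  rw [← WithOne.coe_mul, ← WithOne.coe_mul] at this
  exact WithOne.coe_inj.1 this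

theorem mul_plus_eq_plus (h : IsAmple plus star) {a x : S} (e : x * a = a) :
    x * plus a = plus a := by
  rw [h.mul_plus_cancel (e.trans (h.plus_mul_self a).symm), h.plus_idem]

theorem star_mul_eq_star (h : IsAmple plus star) {a x : S} (e : a * x = a) :
    star a * x = star a := by
  rw [h.star_mul_cancel (e.trans (h.mul_star_self a).symm), h.star_idem]

theorem plus_of_idem (h : IsAmple plus star) {e : S} (he : e * e = e) : plus e = e := by
  rw [← h.mul_plus_eq_plus he, h.comm _ _ he (h.plus_idem e), h.plus_mul_self]

theorem star_of_idem (h : IsAmple plus star) {e : S} (he : e * e = e) : star e = e := by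
  rw [← h.star_mul_eq_star he, ← h.comm _ _ he (h.star_idem e), h.mul_star_self]

theorem plus_mul_of_mul_plus (h : IsAmple plus star) {b s : S} (hb : b * plus s = b) :
    plus (b * s) = plus b := by
  have h1 : plus (b * s) * plus b = plus b :=
    h.mul_plus_eq_plus (by rw [← h.mul_plus, hb])
  have h2 : plus b * plus (b * s) = plus (b * s) :=
    h.mul_plus_eq_plus (by rw [← mul_assoc, h.plus_mul_self])
  rw [← h2, h.comm _ _ (h.plus_idem _) (h.plus_idem _), h1]

/-- Left multiplication by a fixed element is stable along elements with equal `plus`. -/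
theorem mul_eq_self_of_plus_eq (h : IsAmple plus star) {a b x : S} (hab : plus a = plus b)
    (hx : x * a = a) : x * b = b := by
  have h1 : x * plus b = plus b := hab ▸ h.mul_plus_eq_plus hx
  calc x * b = x * plus b * b := by rw [mul_assoc, h.plus_mul_self]
    _ = b := by rw [h1, h.plus_mul_self]

theorem eq_of_mul_eq (h : IsAmple plus star) {x a b : S} (e : x * a = x * b)
    (ha : star x * a = a) (hb : star x * b = b) : a = b := by
  rw [← ha, ← hb, h.star_mul_cancel e]

/-- If `x` acts reversibly on `a` and `u` on `x * a`, then `u * x` acts reversibly on `a`. -/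
theorem star_mul_mul_eq (h : IsAmple plus star) {u x a : S} (hx : star x * a = a)
    (hu : star u * (x * a) = x * a) : star (u * x) * a = a := by
  have h1 : x * (star (u * x) * a) = x * a := by
    rw [← mul_assoc, ← h.star_mul, mul_assoc, hu]
  have h2 := h.star_mul_cancel h1
  rwa [← mul_assoc, h.comm _ _ (h.star_idem _) (h.star_idem _), mul_assoc, hx] at h2

theorem star_mul_eq_mul_star (h : IsAmple plus star) {b c u v : S} (e : u * b = v * c)
    (hu : b * star c = star u * b) : star v * c = c * star b := by
  have h1 : star b * star (u * b) = star b * star c :=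
    h.star_mul_cancel (by rw [hu, h.star_mul])
  have h2 : star (u * b) * star b = star (u * b) :=
    h.star_mul_eq_star (by rw [mul_assoc, h.mul_star_self])
  have h3 : star (u * b) = star c * star b := by
    rw [← h2, h.comm _ _ (h.star_idem _) (h.star_idem _), h1,
      h.comm _ _ (h.star_idem _) (h.star_idem _)]
  rw [h.star_mul, ← e, h3, ← mul_assoc, h.mul_star_self]

/-- The relation on pairs `(a, b)`, thought of as formal quotients `a⁻¹ * b`, identifying
pairs with a common multiple from the left that loses no information. -/
def quotientSetoid (h : IsAmple plus star) (hq : LeftOreSquare plus star) :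
    Setoid {p : S × S // plus p.1 = plus p.2} where
  r p q := ∃ x y : S, x * p.1.1 = y * q.1.1 ∧ x * p.1.2 = y * q.1.2 ∧
    star x * p.1.1 = p.1.1 ∧ star y * q.1.1 = q.1.1
  iseqv := by
    refine ⟨fun p => ?_, ?_, ?_⟩
    · refine ⟨plus p.1.1, plus p.1.1, rfl, rfl, ?_, ?_⟩ <;>
        rw [h.star_of_idem (h.plus_idem _), h.plus_mul_self]
    · rintro p q ⟨x, y, h1, h2, h3, h4⟩
      exact ⟨y, x, h1.symm, h2.symm, h4, h3⟩
    · rintro ⟨⟨a, b⟩, hab⟩ ⟨⟨c, d⟩, hcd⟩ ⟨⟨e, f⟩, hef⟩ ⟨x, y, h1, h2, h3, h4⟩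
        ⟨z, w, k1, k2, k3, k4⟩
      dsimp only at *
      obtain ⟨u, v, huv, -, -, hu⟩ := hq y z
      have hv := h.star_mul_eq_mul_star huv hu
      refine ⟨u * x, v * w, ?_, ?_, h.star_mul_mul_eq h3 ?_, h.star_mul_mul_eq k4 ?_⟩
      · rw [mul_assoc, h1, ← mul_assoc, huv, mul_assoc, k1, mul_assoc]
      · rw [mul_assoc, h2, ← mul_assoc, huv, mul_assoc, k2, mul_assoc]
      · rw [h1, ← mul_assoc, ← hu, mul_assoc, k3]
      · rw [← k1, ← mul_assoc, hv, mul_assoc, h4]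

/-- The partial injection of formal quotients given by right multiplication by `s`. -/
def rightMul (h : IsAmple plus star) (hq : LeftOreSquare plus star) (s : S)
    (x y : Quotient (h.quotientSetoid hq)) : Prop :=
  ∃ p q : {p : S × S // plus p.1 = plus p.2}, Quotient.mk _ p = x ∧ Quotient.mk _ q = y ∧
    p.1.1 = q.1.1 ∧ p.1.2 * plus s = p.1.2 ∧ q.1.2 = p.1.2 * s

variable (h : IsAmple plus star) (hq : LeftOreSquare plus star)

theorem rightMul_mk {a b s : S} (hab : plus a = plus b) (hb : b * plus s = b) :
    h.rightMul hq s (Quotient.mk _ ⟨(a, b), hab⟩)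
      (Quotient.mk _ ⟨(a, b * s), hab.trans (h.plus_mul_of_mul_plus hb).symm⟩) :=
  ⟨_, _, rfl, rfl, rfl, hb, rfl⟩

theorem mul_plus_eq_of_equiv {p q : {p : S × S // plus p.1 = plus p.2}} {s : S}
    (e : (Quotient.mk (h.quotientSetoid hq) p) = Quotient.mk _ q)
    (hp : p.1.2 * plus s = p.1.2) : q.1.2 * plus s = q.1.2 := by
  obtain ⟨x, y, -, h2, -, h4⟩ := Quotient.exact e
  have h5 := h.mul_eq_self_of_plus_eq q.2 h4
  refine h.eq_of_mul_eq (x := y) ?_ (by rw [← mul_assoc, h5]) h5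
  rw [← mul_assoc, ← h2, mul_assoc, hp]

theorem rightMul_functional {s : S} {x y z : Quotient (h.quotientSetoid hq)}
    (hy : h.rightMul hq s x y) (hz : h.rightMul hq s x z) : y = z := by
  obtain ⟨⟨⟨a, b⟩, hp⟩, ⟨⟨a', b'⟩, hp'⟩, rfl, rfl, h1, h2, h3⟩ := hy
  obtain ⟨⟨⟨c, d⟩, kp⟩, ⟨⟨c', d'⟩, kp'⟩, e, rfl, k1, k2, k3⟩ := hz
  dsimp only at *
  subst h1 h3 k1 k3
  obtain ⟨x, y, e1, e2, e3, e4⟩ := Quotient.exact e.symm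
  refine Quotient.sound ⟨x, y, e1, ?_, e3, e4⟩
  dsimp only at *
  rw [← mul_assoc, e2, mul_assoc]

theorem rightMul_injective {s : S} {x y z : Quotient (h.quotientSetoid hq)}
    (hx : h.rightMul hq s x z) (hy : h.rightMul hq s y z) : x = y := by
  obtain ⟨⟨⟨a, b⟩, hp⟩, ⟨⟨a', b'⟩, hp'⟩, rfl, rfl, h1, h2, h3⟩ := hx
  obtain ⟨⟨⟨c, d⟩, kp⟩, ⟨⟨c', d'⟩, kp'⟩, rfl, e, k1, k2, k3⟩ := hy
  dsimp only at *
  subst h1 h3 k1 k3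
  obtain ⟨x, y, e1, e2, e3, e4⟩ := Quotient.exact e.symm
  refine Quotient.sound ⟨x, y, e1, ?_, e3, e4⟩
  dsimp only at *
  rw [← mul_assoc, ← mul_assoc] at e2
  have e5 := h.mul_plus_cancel e2
  rwa [mul_assoc, mul_assoc, h2, k2] at e5

theorem rightMul_mul (s t : S) (x z : Quotient (h.quotientSetoid hq)) :
    h.rightMul hq (s * t) x z ↔ ∃ y, h.rightMul hq s x y ∧ h.rightMul hq t y z := by
  constructor
  · rintro ⟨⟨⟨a, b⟩, hp⟩, ⟨⟨a', b'⟩, hp'⟩, rfl, rfl, h1, h2, h3⟩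
    dsimp only at *
    subst h1 h3
    have hst : plus s * plus (s * t) = plus (s * t) :=
      h.mul_plus_eq_plus (by rw [← mul_assoc, h.plus_mul_self])
    have hs : b * plus s = b := by
      rw [← h2, mul_assoc, h.comm _ _ (h.plus_idem _) (h.plus_idem _), hst]
    have ht : b * s * plus t = b * s := by
      rw [h.mul_plus, mul_assoc b s t, h.plus_mul_of_mul_plus h2, ← mul_assoc, h.plus_mul_self]
    refine ⟨_, h.rightMul_mk hq hp hs, ⟨_, _, rfl, rfl, rfl, ht, (mul_assoc _ _ _).symm⟩⟩
  · rintro ⟨y, ⟨⟨⟨a, b⟩, hp⟩, ⟨⟨a', b'⟩, hp'⟩, rfl, rfl, h1, h2, h3⟩, hy⟩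
    dsimp only at *
    subst h1 h3
    have ht : b * s * plus t = b * s := by
      obtain ⟨p, q, e, -, -, k, -⟩ := hy
      exact h.mul_plus_eq_of_equiv hq e k
    have hst : b * plus (s * t) = b := by
      have h3 : plus (b * s * t) * b * s = b * s := by rw [mul_assoc, ← h.mul_plus, ht]
      have h4 := h.mul_plus_cancel h3
      rw [mul_assoc, h2] at h4
      rw [h.mul_plus, ← mul_assoc, h4]
    rw [h.rightMul_functional hq hy (h.rightMul_mk hq hp' ht)]
    exact ⟨_, _, rfl, rfl, rfl, hst, mul_assoc _ _ _⟩

theorem rightMul_plus (s : S) (x y : Quotient (h.quotientSetoid hq)) :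
    h.rightMul hq (plus s) x y ↔ x = y ∧ ∃ z, h.rightMul hq s x z := by
  constructor
  · rintro ⟨⟨⟨a, b⟩, hp⟩, ⟨⟨a', b'⟩, hp'⟩, rfl, rfl, h1, h2, h3⟩
    dsimp only at *
    rw [h.plus_of_idem (h.plus_idem s)] at h2
    rw [h2] at h3
    subst h1 h3
    exact ⟨rfl, _, h.rightMul_mk hq hp h2⟩
  · rintro ⟨rfl, z, ⟨⟨a, b⟩, hp⟩, -, rfl, -, -, h2, -⟩
    exact ⟨_, _, rfl, rfl, rfl, by rwa [h.plus_of_idem (h.plus_idem s)], h2.symm⟩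

theorem rightMul_star (s : S) (x y : Quotient (h.quotientSetoid hq)) :
    h.rightMul hq (star s) x y ↔ x = y ∧ ∃ z, h.rightMul hq s z x := by
  constructor
  · rintro ⟨⟨⟨c, d⟩, hp⟩, ⟨⟨c', d'⟩, hp'⟩, rfl, rfl, h1, h2, h3⟩
    dsimp only at *
    rw [h.plus_of_idem (h.star_idem s)] at h2
    rw [h2] at h3
    subst h1
    subst d'
    refine ⟨rfl, ?_⟩
    obtain ⟨u, v, e, huv, hv, hu⟩ := hq d s
    rw [h2] at hu
    have hvs : v * plus s = v := by rw [h.mul_plus, ← hv, h.plus_mul_self]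
    have hd : plus (u * d) = plus v := by rw [e, hv]
    have hc : plus (u * c) = plus v := by
      have h5 : u * plus d = u := by rw [h.mul_plus, hd, ← huv, h.plus_mul_self]
      rw [h.plus_mul_of_mul_plus (hp ▸ h5), huv]
    refine ⟨_, ⟨⟨(u * c, v), hc⟩, ⟨(u * c, v * s), hc.trans hv⟩, rfl, ?_, rfl, hvs, rfl⟩⟩
    have huc : star u * c = c := h.mul_eq_self_of_plus_eq hp.symm hu.symm
    have hud : star (plus (u * c)) * (u * c) = u * c := by
      rw [h.star_of_idem (h.plus_idem _), h.plus_mul_self]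
    refine Quotient.sound ⟨plus (u * c), u, h.plus_mul_self _, ?_, hud, huc⟩
    dsimp only
    rw [hc, hv, h.plus_mul_self, e]
  · rintro ⟨rfl, z, ⟨⟨a, b⟩, hp⟩, ⟨⟨a', b'⟩, hp'⟩, -, rfl, h1, -, h3⟩
    dsimp only at *
    subst h1 h3
    have h4 : b * s * star s = b * s := by rw [mul_assoc, h.mul_star_self]
    exact ⟨_, _, rfl, rfl, rfl, by rwa [h.plus_of_idem (h.star_idem s)], h4.symm⟩

theorem plus_mul_plus_of_rightMul_eq {s t : S} (e : h.rightMul hq s = h.rightMul hq t) :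
    plus s * plus t = plus s := by
  have h1 := h.rightMul_mk hq (rfl : plus (plus s) = _) (h.plus_idem s)
  rw [e] at h1
  obtain ⟨p, q, e1, -, -, k, -⟩ := h1
  exact h.mul_plus_eq_of_equiv hq e1 k

theorem rightMul_faithful {s t : S} (e : h.rightMul hq s = h.rightMul hq t) : s = t := by
  have hst : plus s = plus t := by
    rw [← h.plus_mul_plus_of_rightMul_eq hq e, h.comm _ _ (h.plus_idem _) (h.plus_idem _),
      h.plus_mul_plus_of_rightMul_eq hq e.symm]
  have hs := h.rightMul_mk hq (rfl : plus (plus s) = _) (h.plus_idem s)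
  have ht := h.rightMul_mk hq (rfl : plus (plus s) = _)
    (h.plus_mul_plus_of_rightMul_eq hq e)
  rw [e] at hs
  obtain ⟨x, y, e1, e2, e3, e4⟩ := Quotient.exact (h.rightMul_functional hq hs ht)
  dsimp only at *
  have e5 : plus s * t = t := by rw [hst, h.plus_mul_self]
  rw [h.plus_mul_self, e5] at e2
  have e6 : y * s = y * t := by
    rw [← e2, ← h.plus_mul_self s, ← mul_assoc, ← mul_assoc, e1]
  have e7 : star y * s = s := by
    rw [← h.plus_mul_self s, ← mul_assoc, e4]
  exact h.eq_of_mul_eq e6 e7 (h.mul_eq_self_of_plus_eq hst e7)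

/-- The relation `φ(a)⁻¹ φ(b)`, where `φ` is `rightMul`. -/
def fraction (a b : S) (x y : Quotient (h.quotientSetoid hq)) : Prop :=
  ∃ w, h.rightMul hq a w x ∧ h.rightMul hq b w y

theorem fraction_functional {a b : S} {x y z : Quotient (h.quotientSetoid hq)}
    (hy : h.fraction hq a b x y) (hz : h.fraction hq a b x z) : y = z := by
  obtain ⟨w, h1, h2⟩ := hy
  obtain ⟨w', k1, k2⟩ := hz
  obtain rfl := h.rightMul_injective hq h1 k1
  exact h.rightMul_functional hq h2 k2

theorem fraction_swap {a b : S} {x y : Quotient (h.quotientSetoid hq)} :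
    h.fraction hq a b x y ↔ h.fraction hq b a y x :=
  exists_congr fun _ => and_comm

theorem fraction_plus (s : S) : h.fraction hq (plus s) s = h.rightMul hq s := by
  ext x y
  constructor
  · rintro ⟨w, h1, h2⟩
    rwa [← ((h.rightMul_plus hq s w x).1 h1).1]
  · exact fun h1 => ⟨x, (h.rightMul_plus hq s x x).2 ⟨rfl, y, h1⟩, h1⟩

/-- The square condition computes `φ(b) φ(c)⁻¹` as `φ(u)⁻¹ φ(v)`. -/
theorem fraction_eq_of_square {b c u v : S} (e : u * b = v * c) (huv : plus u = plus v)
    (hv : plus v = plus (v * c)) (hu : b * star c = star u * b)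
    (x z : Quotient (h.quotientSetoid hq)) :
    h.fraction hq u v x z ↔ ∃ y, h.rightMul hq b x y ∧ h.rightMul hq c z y := by
  constructor
  · rintro ⟨w, h1, h2⟩
    have h3 : h.rightMul hq (plus v) w w := (h.rightMul_plus hq v w w).2 ⟨rfl, z, h2⟩
    rw [hv] at h3
    obtain ⟨-, y, h4⟩ := (h.rightMul_plus hq _ w w).1 h3
    obtain ⟨z', h5, h6⟩ := (h.rightMul_mul hq v c w y).1 h4
    obtain rfl := h.rightMul_functional hq h2 h5
    rw [← e] at h4
    obtain ⟨x', h7, h8⟩ := (h.rightMul_mul hq u b w y).1 h4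
    obtain rfl := h.rightMul_functional hq h1 h7
    exact ⟨y, h8, h6⟩
  · rintro ⟨y, h1, h2⟩
    have h3 : h.rightMul hq (b * star c) x y :=
      (h.rightMul_mul hq _ _ x y).2 ⟨y, h1, (h.rightMul_star hq c y y).2 ⟨rfl, z, h2⟩⟩
    rw [hu] at h3
    obtain ⟨x', h4, -⟩ := (h.rightMul_mul hq _ _ x y).1 h3
    obtain ⟨rfl, w, h5⟩ := (h.rightMul_star hq u x x').1 h4
    have h6 : h.rightMul hq (plus u) w w := (h.rightMul_plus hq u w w).2 ⟨rfl, x, h5⟩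
    rw [huv] at h6
    obtain ⟨-, z', h7⟩ := (h.rightMul_plus hq v w w).1 h6
    have h8 : h.rightMul hq (v * c) w y := e ▸ (h.rightMul_mul hq u b w y).2 ⟨x, h5, h1⟩
    obtain ⟨z'', h9, h10⟩ := (h.rightMul_mul hq v c w y).1 h8
    obtain rfl := h.rightMul_injective hq h2 h10
    exact ⟨w, h5, h9⟩

theorem exists_fraction_comp (a b c d : S) : ∃ a' d' : S,
    (fun x z => ∃ y, h.fraction hq a b x y ∧ h.fraction hq c d y z) = h.fraction hq a' d' := by
  obtain ⟨u, v, e, huv, hv, hu⟩ := hq b c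
  have key := h.fraction_eq_of_square hq e huv hv hu
  refine ⟨u * a, v * d, ?_⟩
  ext x z
  constructor
  · rintro ⟨y, ⟨w, h1, h2⟩, w', h3, h4⟩
    obtain ⟨t, h5, h6⟩ := (key w w').2 ⟨y, h2, h3⟩
    exact ⟨t, (h.rightMul_mul hq _ _ _ _).2 ⟨w, h5, h1⟩,
      (h.rightMul_mul hq _ _ _ _).2 ⟨w', h6, h4⟩⟩
  · rintro ⟨t, h1, h2⟩
    obtain ⟨w, h3, h4⟩ := (h.rightMul_mul hq _ _ _ _).1 h1
    obtain ⟨w', h5, h6⟩ := (h.rightMul_mul hq _ _ _ _).1 h2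
    obtain ⟨y, h7, h8⟩ := (key w w').1 ⟨t, h3, h5⟩
    exact ⟨y, ⟨w, h4, h7⟩, w', h8, h6⟩

/-- The inverse semigroup of left I-quotients of `S`, realized by partial injections. -/
def LeftIQuotients : Type _ :=
  {R : Quotient (h.quotientSetoid hq) → Quotient (h.quotientSetoid hq) → Prop //
    ∃ a b, R = h.fraction hq a b}

namespace LeftIQuotients

variable {h hq}

theorem functional (R : h.LeftIQuotients hq) {x y z} (hy : R.1 x y) (hz : R.1 x z) : y = z := by
  obtain ⟨_, a, b, rfl⟩ := R
  exact h.fraction_functional hq hy hz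

theorem injective (R : h.LeftIQuotients hq) {x y z} (hx : R.1 x z) (hy : R.1 y z) : x = y := by
  obtain ⟨_, a, b, rfl⟩ := R
  exact h.fraction_functional hq ((h.fraction_swap hq).1 hx) ((h.fraction_swap hq).1 hy)

/-- Composition of partial injections. -/
def comp (R T : h.LeftIQuotients hq) : h.LeftIQuotients hq :=
  ⟨fun x z => ∃ y, R.1 x y ∧ T.1 y z, by
    obtain ⟨_, a, b, rfl⟩ := R
    obtain ⟨_, c, d, rfl⟩ := T
    exact h.exists_fraction_comp hq a b c d⟩

/-- The inverse partial injection. -/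
def inverse (R : h.LeftIQuotients hq) : h.LeftIQuotients hq :=
  ⟨fun x y => R.1 y x, by
    obtain ⟨_, a, b, rfl⟩ := R
    exact ⟨b, a, by ext x y; exact h.fraction_swap hq⟩⟩

/-- The embedding of `S` by right multiplications. -/
def of (h : IsAmple plus star) (hq : LeftOreSquare plus star) (s : S) :
    h.LeftIQuotients hq :=
  ⟨h.rightMul hq s, plus s, s, (h.fraction_plus hq s).symm⟩

theorem ext_rel {R T : h.LeftIQuotients hq} (e : ∀ x y, R.1 x y ↔ T.1 x y) : R = T :=
  Subtype.ext (by ext x y; exact e x y)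

theorem eq_of_idem {R : h.LeftIQuotients hq} (hR : comp R R = R) {x y} (hxy : R.1 x y) :
    x = y := by
  have h1 : (comp R R).1 x y := by rwa [hR]
  obtain ⟨z, h2, h3⟩ := h1
  obtain rfl := R.functional hxy h2
  exact R.injective hxy h3

theorem comp_assoc (R T U : h.LeftIQuotients hq) : comp (comp R T) U = comp R (comp T U) :=
  ext_rel fun _ _ =>
    ⟨fun ⟨z, ⟨w, h1, h2⟩, h3⟩ => ⟨w, h1, z, h2, h3⟩,
      fun ⟨w, h1, z, h2, h3⟩ => ⟨z, ⟨w, h1, h2⟩, h3⟩⟩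

theorem comp_inverse_comp (R : h.LeftIQuotients hq) : comp (comp R (inverse R)) R = R := by
  refine ext_rel fun x y => ⟨?_, fun h1 => ⟨x, ⟨y, h1, h1⟩, h1⟩⟩
  rintro ⟨z, ⟨w, h1, h2⟩, h3⟩
  obtain rfl := R.injective h1 h2
  exact h3

theorem comp_comm_of_idem {R T : h.LeftIQuotients hq} (hR : comp R R = R) (hT : comp T T = T) :
    comp R T = comp T R := by
  refine ext_rel fun x y => ⟨?_, ?_⟩
  · rintro ⟨z, h1, h2⟩
    obtain rfl := eq_of_idem hR h1
    obtain rfl := eq_of_idem hT h2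
    exact ⟨_, h2, h1⟩
  · rintro ⟨z, h1, h2⟩
    obtain rfl := eq_of_idem hT h1
    obtain rfl := eq_of_idem hR h2
    exact ⟨_, h2, h1⟩

theorem of_mul (s t : S) : of h hq (s * t) = comp (of h hq s) (of h hq t) :=
  ext_rel (h.rightMul_mul hq s t)

theorem of_injective : Function.Injective (of h hq) := fun _ _ e =>
  h.rightMul_faithful hq (congrArg Subtype.val e)

theorem of_plus (s : S) : of h hq (plus s) = comp (of h hq s) (inverse (of h hq s)) := by
  refine ext_rel fun x y => (h.rightMul_plus hq s x y).trans ⟨?_, ?_⟩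
  · rintro ⟨rfl, z, h1⟩
    exact ⟨z, h1, h1⟩
  · rintro ⟨z, h1, h2⟩
    exact ⟨h.rightMul_injective hq h1 h2, z, h1⟩

theorem of_star (s : S) : of h hq (star s) = comp (inverse (of h hq s)) (of h hq s) := by
  refine ext_rel fun x y => (h.rightMul_star hq s x y).trans ⟨?_, ?_⟩
  · rintro ⟨rfl, z, h1⟩
    exact ⟨z, h1, h1⟩
  · rintro ⟨z, h1, h2⟩
    exact ⟨h.rightMul_functional hq h1 h2, z, h1⟩

theorem exists_eq_inverse_comp (R : h.LeftIQuotients hq) :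
    ∃ a b : S, R = comp (inverse (of h hq a)) (of h hq b) := by
  obtain ⟨_, a, b, rfl⟩ := R
  exact ⟨a, b, rfl⟩

end LeftIQuotients

end IsAmple

/-- `inv` makes the semigroup `Q` an inverse semigroup. -/
structure IsInverseSemigroup {Q : Type*} [Semigroup Q] (inv : Q → Q) : Prop where
  mul_inv_mul : ∀ a : Q, a * inv a * a = a
  inv_mul_inv : ∀ a : Q, inv a * a * inv a = inv a
  comm : ∀ e f : Q, e * e = e → f * f = f → e * f = f * e

namespace IsInverseSemigroup

variable {Q : Type*} [Semigroup Q] {inv : Q → Q}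

theorem mul_inv_idem (h : IsInverseSemigroup inv) (a : Q) :
    (a * inv a) * (a * inv a) = a * inv a := by
  rw [← mul_assoc, h.mul_inv_mul]

theorem inv_mul_idem (h : IsInverseSemigroup inv) (a : Q) :
    (inv a * a) * (inv a * a) = inv a * a := by
  rw [← mul_assoc, h.inv_mul_inv]

theorem inv_eq_of_mul (h : IsInverseSemigroup inv) {a b : Q} (hab : a * b * a = a)
    (hba : b * a * b = b) : inv a = b := by
  have i1 : (a * b) * (a * b) = a * b := by rw [← mul_assoc, hab]
  have i2 : (b * a) * (b * a) = b * a := by rw [← mul_assoc, hba]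
  calc inv a = inv a * (a * b * a) * inv a := by rw [hab, h.inv_mul_inv]
    _ = (inv a * a) * (b * a) * inv a := by simp only [mul_assoc]
    _ = (b * a) * (inv a * a) * inv a := by rw [h.comm _ _ (h.inv_mul_idem a) i2]
    _ = b * (a * inv a) := by rw [mul_assoc _ _ (inv a), h.inv_mul_inv, mul_assoc]
    _ = b * a * b * (a * inv a) := by rw [hba]
    _ = b * ((a * b) * (a * inv a)) := by simp only [mul_assoc]
    _ = b * ((a * inv a) * (a * b)) := by rw [h.comm _ _ i1 (h.mul_inv_idem a)]
    _ = b * (a * inv a * a) * b := by simp only [mul_assoc]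
    _ = b := by rw [h.mul_inv_mul, hba]

theorem inv_inv (h : IsInverseSemigroup inv) (a : Q) : inv (inv a) = a :=
  h.inv_eq_of_mul (h.inv_mul_inv a) (h.mul_inv_mul a)

theorem mul_mul_inv_mul (h : IsInverseSemigroup inv) (a b : Q) :
    a * b * (inv b * inv a) * (a * b) = a * b := by
  calc a * b * (inv b * inv a) * (a * b) = a * ((b * inv b) * (inv a * a)) * b := by
        simp only [mul_assoc]
    _ = a * ((inv a * a) * (b * inv b)) * b := by
        rw [h.comm _ _ (h.mul_inv_idem b) (h.inv_mul_idem a)]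
    _ = (a * inv a * a) * (b * inv b * b) := by simp only [mul_assoc]
    _ = a * b := by rw [h.mul_inv_mul, h.mul_inv_mul]

theorem mul_inv_rev (h : IsInverseSemigroup inv) (a b : Q) : inv (a * b) = inv b * inv a := by
  refine h.inv_eq_of_mul (h.mul_mul_inv_mul a b) ?_
  have := h.mul_mul_inv_mul (inv b) (inv a)
  rwa [h.inv_inv, h.inv_inv] at this

/-- Any `a⁻¹ d` can be rewritten as `u⁻¹ v` with `u 𝓡 v`, where `u = d d⁻¹ a` and
`v = a a⁻¹ d`. -/
theorem inv_mul_eq_balanced (h : IsInverseSemigroup inv) (a d : Q) :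
    inv (d * inv d * a) * (a * inv a * d) = inv a * d ∧
    (d * inv d * a) * inv (d * inv d * a) = (a * inv a * d) * inv (a * inv a * d) := by
  have ha := h.mul_inv_idem a
  have hd := h.mul_inv_idem d
  have hc := h.comm _ _ ha hd
  simp only [h.mul_inv_rev, h.inv_inv]
  constructor
  · calc inv a * (d * inv d) * (a * inv a * d)
        = inv a * ((d * inv d) * (a * inv a)) * d := by simp only [mul_assoc]
      _ = (inv a * a * inv a) * (d * inv d * d) := by rw [← hc]; simp only [mul_assoc]
      _ = inv a * d := by rw [h.inv_mul_inv, h.mul_inv_mul]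
  · calc d * inv d * a * (inv a * (d * inv d))
        = ((d * inv d) * (a * inv a)) * (d * inv d) := by simp only [mul_assoc]
      _ = (a * inv a) * (d * inv d) := by rw [← hc, mul_assoc, hd]
      _ = (a * inv a) * ((a * inv a) * (d * inv d)) := by
        rw [← mul_assoc (a * inv a) (a * inv a), ha]
      _ = (a * inv a) * ((d * inv d) * (a * inv a)) := by rw [hc]
      _ = a * inv a * d * (inv d * (a * inv a)) := by simp only [mul_assoc]

/-- If `b c⁻¹ = u⁻¹ v` with `u 𝓡 v`, then `u, v` satisfy the square condition. -/
theorem square_of_mul_inv_eq (h : IsInverseSemigroup inv) {b c u v : Q}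
    (e : b * inv c = inv u * v) (huv : u * inv u = v * inv v) :
    u * b = v * c ∧ v * inv v = (v * c) * inv (v * c) ∧
      b * (inv c * c) = (inv u * u) * b := by
  have e' : c * inv b = inv v * u := by
    have := congrArg inv e
    rwa [h.mul_inv_rev, h.mul_inv_rev, h.inv_inv, h.inv_inv] at this
  have hu : inv u * u = b * (inv c * c) * inv b := by
    calc inv u * u = inv u * (u * inv u) * u := by rw [← mul_assoc, h.inv_mul_inv]
      _ = (inv u * v) * (inv v * u) := by rw [huv]; simp only [mul_assoc]
      _ = b * (inv c * c) * inv b := by rw [← e, ← e']; simp only [mul_assoc]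
  have hv : inv v * v = c * (inv b * b) * inv c := by
    calc inv v * v = inv v * (v * inv v) * v := by rw [← mul_assoc, h.inv_mul_inv]
      _ = (inv v * u) * (inv u * v) := by rw [← huv]; simp only [mul_assoc]
      _ = c * (inv b * b) * inv c := by rw [← e, ← e']; simp only [mul_assoc]
  have hub : b * (inv c * c) = (inv u * u) * b := by
    calc b * (inv c * c) = (b * inv b * b) * (inv c * c) := by rw [h.mul_inv_mul]
      _ = b * ((inv b * b) * (inv c * c)) := by simp only [mul_assoc]
      _ = b * ((inv c * c) * (inv b * b)) := by
        rw [h.comm _ _ (h.inv_mul_idem b) (h.inv_mul_idem c)]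
      _ = (inv u * u) * b := by rw [hu]; simp only [mul_assoc]
  refine ⟨?_, ?_, hub⟩
  · calc u * b = (u * inv u * u) * b := by rw [h.mul_inv_mul]
      _ = u * ((inv u * u) * b) := by simp only [mul_assoc]
      _ = u * (b * inv c) * c := by rw [← hub]; simp only [mul_assoc]
      _ = (u * inv u) * v * c := by rw [e]; simp only [mul_assoc]
      _ = v * c := by rw [huv, h.mul_inv_mul]
  · have hvc : v * (c * inv c) = v := by
      calc v * (c * inv c) = (v * inv v * v) * (c * inv c) := by rw [h.mul_inv_mul]
        _ = v * (inv v * v) * (c * inv c) := by simp only [mul_assoc]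
        _ = v * (c * (inv b * b) * (inv c * c * inv c)) := by rw [hv]; simp only [mul_assoc]
        _ = v * (inv v * v) := by rw [h.inv_mul_inv, hv]
        _ = v := by rw [← mul_assoc, h.mul_inv_mul]
    calc v * inv v = v * (c * inv c) * inv v := by rw [hvc]
      _ = (v * c) * inv (v * c) := by rw [h.mul_inv_rev]; simp only [mul_assoc]

/-- A bi-unary semigroup that is a left I-order in an inverse semigroup satisfies the
square condition. -/
theorem leftOreSquare (h : IsInverseSemigroup inv) {S : Type*} [Semigroup S]
    {plus star : S → S} (φ : S → Q) (hmul : ∀ a b : S, φ (a * b) = φ a * φ b)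
    (hinj : Function.Injective φ) (hplus : ∀ a : S, φ (plus a) = φ a * inv (φ a))
    (hstar : ∀ a : S, φ (star a) = inv (φ a) * φ a)
    (hfrac : ∀ q : Q, ∃ a b : S, q = inv (φ a) * φ b) : LeftOreSquare plus star := by
  intro b c
  obtain ⟨a, d, had⟩ := hfrac (φ b * inv (φ c))
  obtain ⟨hq, huv⟩ := h.inv_mul_eq_balanced (φ a) (φ d)
  rw [← hplus, ← hplus, ← hmul, ← hmul] at hq huv
  obtain ⟨h1, h2, h3⟩ := h.square_of_mul_inv_eq (had.trans hq.symm) huv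
  refine ⟨plus d * a, plus a * d, hinj ?_, hinj ?_, hinj ?_, hinj ?_⟩
  · rw [hmul _ b, hmul _ c, h1]
  · rw [hplus, hplus, huv]
  · rw [hplus, h2, ← hmul, ← hplus]
  · rw [hmul, hmul _ b, hstar, hstar, h3]

end IsInverseSemigroup

/-- Corollary `twosidedample`: an ample semigroup `S` has a semigroup
of left I-quotients in which it embeds as a bi-unary semigroup iff for all `b, c ∈ S`
there exist `u, v ∈ S` with `u·b = v·c`, `u⁺ = v⁺ = (v·c)⁺` and `b·c* = u*·b`. -/
theorem ample_leftIOrder_iff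
    {S : Type u} [Semigroup S] (plus star : S → S)
    (hcomm : ∀ e f : S, e * e = e → f * f = f → e * f = f * e)
    (hplusidem : ∀ a : S, plus a * plus a = plus a)
    (hRstar : ∀ a : S, RStar a (plus a))
    (hstaridem : ∀ a : S, star a * star a = star a)
    (hLstar : ∀ a : S, LeLStar a (star a) ∧ LeLStar (star a) a)
    (hleftample : ∀ a b : S, a * plus b = plus (a * b) * a)
    (hrightample : ∀ a b : S, star a * b = b * star (a * b)) :
    (∃ (Q : Type u) (mul : Q → Q → Q) (inv : Q → Q) (φ : S → Q),
      (∀ a b c : Q, mul (mul a b) c = mul a (mul b c)) ∧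
      (∀ a : Q, mul (mul a (inv a)) a = a) ∧
      (∀ a : Q, mul (mul (inv a) a) (inv a) = inv a) ∧
      (∀ e f : Q, mul e e = e → mul f f = f → mul e f = mul f e) ∧
      (∀ a b : S, φ (a * b) = mul (φ a) (φ b)) ∧
      Function.Injective φ ∧
      (∀ a : S, φ (plus a) = mul (φ a) (inv (φ a))) ∧
      (∀ a : S, φ (star a) = mul (inv (φ a)) (φ a)) ∧
      (∀ q : Q, ∃ a b : S, q = mul (inv (φ a)) (φ b))) ↔
    (∀ b c : S, ∃ u v : S,
      u * b = v * c ∧ plus u = plus v ∧ plus v = plus (v * c) ∧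
      b * star c = star u * b) := by
  have h : IsAmple plus star :=
    ⟨hcomm, hplusidem, hRstar, hstaridem, hLstar, hleftample, hrightample⟩
  constructor
  · rintro ⟨Q, mul, inv, φ, hassoc, h1, h2, h3, hmul, hinj, hplus, hstar, hfrac⟩
    let _ : Semigroup Q := { mul := mul, mul_assoc := hassoc }
    exact IsInverseSemigroup.leftOreSquare (inv := inv) ⟨h1, h2, h3⟩ φ hmul hinj hplus hstar
      hfrac
  · intro hq
    exact ⟨h.LeftIQuotients hq, IsAmple.LeftIQuotients.comp, IsAmple.LeftIQuotients.inverse,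
      IsAmple.LeftIQuotients.of h hq, IsAmple.LeftIQuotients.comp_assoc,
      IsAmple.LeftIQuotients.comp_inverse_comp,
      fun R => IsAmple.LeftIQuotients.comp_inverse_comp R.inverse,
      fun _ _ => IsAmple.LeftIQuotients.comp_comm_of_idem,
      IsAmple.LeftIQuotients.of_mul, IsAmple.LeftIQuotients.of_injective,
      IsAmple.LeftIQuotients.of_plus, IsAmple.LeftIQuotients.of_star,
      IsAmple.LeftIQuotients.exists_eq_inverse_comp⟩
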